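/- Let 𝔅 be a unital C*-algebra, write Im a = (a − a*)/(2i), ℍ⁺(𝔅) = {B ∈ 𝔅 : ∃ε>0, Im B ≥ ε·1}, ℍ⁻(𝔅) = −ℍ⁺(𝔅), and U(0,r) = {B ∈ 𝔅 : ‖B‖ < r}. Let R : ℍ⁻(𝔅) → ℍ⁻(𝔅) be holomorphic and bounded on bounded subsets, i.e. sup{‖R(B)‖ : B ∈ ℍ⁻(𝔅) ∩ U(0,r)} < ∞ for every r > 0. Fix Z ∈ ℍ⁺(𝔅) and define 𝒢_Z(B) = (Z − R(B))^{-1} for B ∈ ℍ⁻(𝔅). Then: (1) 𝒢_Z is a holomorphic self-map of ℍ⁻(𝔅); (2) ‖𝒢_Z(B)‖ ≤ ‖(Im Z)^{-1}‖ for every B ∈ ℍ⁻(𝔅); (3) for any r > ‖(Im Z)^{-1}‖, 𝒢_Z maps U(0,r) ∩ ℍ⁻(𝔅) strictly into itself; (4) the equation B = 𝒢_Z(B) has a unique solution G(Z) in ℍ⁻(𝔅), and for every initial point B₀ ∈ ℍ⁻(𝔅) the iterates 𝒢_Z^{∘n}(B₀) converge in the norm topology to G(Z). -/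

import Mathlib

open Filter Metric

/-- The imaginary part `Im a = (a − a*)/(2i)` of an element of a complex star algebra. -/
noncomputable def imPart {A : Type*} [CStarAlgebra A] (a : A) : A :=
  (2 * Complex.I)⁻¹ • (a - star a)

/-- The operator upper half-plane `ℍ⁺(A) = {a : ∃ ε > 0, Im a ≥ ε·1}`. -/
def upperHalf (A : Type*) [CStarAlgebra A] [PartialOrder A] [StarOrderedRing A] : Set A :=
  {a : A | ∃ ε : ℝ, 0 < ε ∧ (ε : ℂ) • (1 : A) ≤ imPart a}

/-- The operator lower half-plane `ℍ⁻(A) = −ℍ⁺(A)`. -/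
def lowerHalf (A : Type*) [CStarAlgebra A] [PartialOrder A] [StarOrderedRing A] : Set A :=
  {a : A | -a ∈ upperHalf A}

section EarleHamilton

variable {E F : Type*} [NormedAddCommGroup E] [NormedSpace ℂ E] [NormedAddCommGroup F]
  [NormedSpace ℂ F] {D : Set E} {f : E → E}

theorem differentiableOn_iterate (hf : DifferentiableOn ℂ f D) (hfD : Set.MapsTo f D D) (n : ℕ) :
    DifferentiableOn ℂ f^[n] D := by
  induction n with
  | zero => exact differentiableOn_id
  | succ n ih => rw [Function.iterate_succ']; exact hf.comp ih (hfD.iterate n)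

/-- The derivatives of the iterates of a holomorphic self-map `f` of `D` decay geometrically if `D`
is stable under the maps `z ↦ f z + t • (f z - f p)`. -/
theorem norm_fderiv_comp_iterate_le (hD : IsOpen D) (hf : DifferentiableOn ℂ f D)
    (hfD : Set.MapsTo f D D) {t : ℝ} (ht : 0 < t)
    (hft : ∀ p ∈ D, ∀ z ∈ D, f z + (t : ℂ) • (f z - f p) ∈ D) {C δ : ℝ} (hδ : 0 < δ) {x : E}
    (hx : ball x δ ⊆ D) (n : ℕ) {g : E → F} (hg : DifferentiableOn ℂ g D)
    (hgC : ∀ y ∈ D, ‖g y‖ ≤ C) :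
    ‖fderiv ℂ (g ∘ f^[n]) x‖ ≤ 2 * C / δ * ((1 + t)⁻¹) ^ n := by
  have hxD : x ∈ D := hx (mem_ball_self hδ)
  induction n generalizing g with
  | zero =>
    simp only [Function.iterate_zero, Function.comp_id, pow_zero, mul_one]
    refine Complex.norm_fderiv_le_div_of_mapsTo_ball (hg.mono hx) (fun y hy => ?_) hδ
    rw [mem_closedBall, dist_eq_norm]
    linarith [norm_sub_le (g y) (g x), hgC y (hx hy), hgC x hxD]
  | succ n ih =>
    set p := f^[n] x
    have hpD : p ∈ D := hfD.iterate n hxD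
    set h : E → E := fun z => f z + (t : ℂ) • (f z - f p) with hh
    have hhD : Set.MapsTo h D D := fun z hz => hft p hpD z hz
    have hh_diff : DifferentiableOn ℂ h D := hf.add ((hf.sub_const _).const_smul _)
    have key := ih (g := g ∘ h) (hg.comp hh_diff hhD) (fun y hy => hgC _ (hhD hy))
    have hfp : HasFDerivAt f (fderiv ℂ f p) p :=
      (hf.differentiableAt (hD.mem_nhds hpD)).hasFDerivAt
    have hfn : HasFDerivAt f^[n] (fderiv ℂ f^[n] x) x :=
      ((differentiableOn_iterate hf hfD n).differentiableAt (hD.mem_nhds hxD)).hasFDerivAt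
    have hgf : HasFDerivAt g (fderiv ℂ g (f p)) (f p) :=
      (hg.differentiableAt (hD.mem_nhds (hfD hpD))).hasFDerivAt
    have hhp : h p = f p := by simp [hh]
    have hhf : HasFDerivAt h (fderiv ℂ f p + (t : ℂ) • fderiv ℂ f p) p :=
      hfp.add ((hfp.sub_const _).const_smul _)
    have d1 : HasFDerivAt (g ∘ f^[n + 1])
        ((fderiv ℂ g (f p)).comp ((fderiv ℂ f p).comp (fderiv ℂ f^[n] x))) x := by
      rw [Function.iterate_succ']
      exact hgf.comp x (hfp.comp x hfn)
    have d2 : HasFDerivAt ((g ∘ h) ∘ f^[n])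
        (((fderiv ℂ g (f p)).comp (fderiv ℂ f p + (t : ℂ) • fderiv ℂ f p)).comp
          (fderiv ℂ f^[n] x)) x :=
      HasFDerivAt.comp x (HasFDerivAt.comp p (by rwa [hhp]) hhf) hfn
    have hd : fderiv ℂ ((g ∘ h) ∘ f^[n]) x = ((1 + t : ℝ) : ℂ) • fderiv ℂ (g ∘ f^[n + 1]) x := by
      rw [d1.fderiv, d2.fderiv]
      ext v
      simp [add_smul]
    rw [hd, norm_smul, Complex.norm_real, Real.norm_of_nonneg (by positivity)] at key
    rw [pow_succ, ← mul_assoc, ← div_eq_mul_inv, le_div_iff₀ (by positivity), mul_comm]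
    exact key

/-- The **Earle–Hamilton fixed point theorem** for bounded convex domains. -/
theorem exists_fixedPoint_of_strictly_mapsTo [CompleteSpace E] (hD : IsOpen D) (hconv : Convex ℝ D)
    {M : ℝ} (hM : ∀ x ∈ D, ‖x‖ ≤ M) (hne : D.Nonempty) (hf : DifferentiableOn ℂ f D)
    {ε : ℝ} (hε : 0 < ε) (hstrict : ∀ x ∈ D, ball (f x) ε ⊆ D) :
    ∃ G ∈ D, f G = G ∧ ∀ x ∈ D, Tendsto (fun n => f^[n] x) atTop (nhds G) := by
  obtain ⟨x₀, hx₀⟩ := hne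
  have hM0 : 0 ≤ M := (norm_nonneg _).trans (hM x₀ hx₀)
  have hfD : Set.MapsTo f D D := fun x hx => hstrict x hx (mem_ball_self hε)
  set t : ℝ := ε / (2 * M + 1) with ht_def
  have ht : 0 < t := by positivity
  have hft : ∀ p ∈ D, ∀ z ∈ D, f z + (t : ℂ) • (f z - f p) ∈ D := by
    intro p hp z hz
    apply hstrict z hz
    rw [mem_ball, dist_eq_norm, add_sub_cancel_left, norm_smul, Complex.norm_real,
      Real.norm_of_nonneg ht.le, ht_def, div_mul_eq_mul_div, div_lt_iff₀ (by positivity)]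
    gcongr
    linarith [norm_sub_le (f z) (f p), hM _ (hfD hz), hM _ (hfD hp)]
  set q : ℝ := (1 + t)⁻¹
  have hq0 : 0 ≤ q := by positivity
  have hq1 : q < 1 := inv_lt_one_of_one_lt₀ (by linarith)
  have contr : ∀ x ∈ D, ∀ y ∈ D, ∃ K : ℝ, ∀ n, ‖f^[n] x - f^[n] y‖ ≤ K * q ^ n := by
    intro x hx y hy
    obtain ⟨δ, hδ, hδD⟩ : ∃ δ > 0, thickening δ (segment ℝ x y) ⊆ D := by
      refine IsCompact.exists_thickening_subset_open ?_ hD (hconv.segment_subset hx hy)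
      rw [← convexHull_pair]
      exact (Set.toFinite _).isCompact_convexHull (𝕜 := ℝ)
    refine ⟨2 * M / δ * ‖x - y‖, fun n => ?_⟩
    have := (convex_segment (𝕜 := ℝ) x y).norm_image_sub_le_of_norm_fderiv_le (𝕜 := ℂ)
      (f := f^[n]) (C := 2 * M / δ * q ^ n)
      (fun z hz => (differentiableOn_iterate hf hfD n).differentiableAt
        (hD.mem_nhds (hconv.segment_subset hx hy hz)))
      (fun z hz => norm_fderiv_comp_iterate_le hD hf hfD ht hft hδ
        ((ball_subset_thickening hz δ).trans hδD) n differentiableOn_id hM)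
      (right_mem_segment ℝ x y) (left_mem_segment ℝ x y)
    linarith
  have lim0 : ∀ x ∈ D, ∀ y ∈ D, Tendsto (fun n => f^[n] x - f^[n] y) atTop (nhds 0) := by
    intro x hx y hy
    obtain ⟨K, hK⟩ := contr x hx y hy
    refine squeeze_zero_norm hK ?_
    simpa using (tendsto_pow_atTop_nhds_zero_of_lt_one hq0 hq1).const_mul K
  obtain ⟨K, hK⟩ := contr x₀ hx₀ (f x₀) (hfD hx₀)
  obtain ⟨G, hG⟩ := cauchySeq_tendsto_of_complete
    (cauchySeq_of_le_geometric q K hq1 (f := fun n => f^[n] x₀) (fun n => by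
      rw [dist_eq_norm, Function.iterate_succ_apply]; exact hK n))
  have hGD : G ∈ D := by
    obtain ⟨n, hn⟩ := ((tendsto_add_atTop_iff_nat 1).2 hG |>.eventually
      (ball_mem_nhds G hε)).exists
    rw [Function.iterate_succ_apply'] at hn
    exact hstrict _ (hfD.iterate n hx₀) (mem_ball_comm.1 hn)
  have hfG : f G = G := by
    refine tendsto_nhds_unique ?_ ((tendsto_add_atTop_iff_nat 1).2 hG)
    simp only [Function.iterate_succ_apply']
    exact ((hf.differentiableAt (hD.mem_nhds hGD)).continuousAt.tendsto).comp hG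
  refine ⟨G, hGD, hfG, fun x hx => ?_⟩
  have := lim0 x hx G hGD
  simp only [Function.iterate_fixed hfG] at this
  simpa using this.add_const G

end EarleHamilton

section HalfPlane

variable {A : Type*} [CStarAlgebra A]

theorem imPart_add (a b : A) : imPart (a + b) = imPart a + imPart b := by
  simp only [imPart, star_add, ← smul_add]
  congr 1
  abel

theorem imPart_neg (a : A) : imPart (-a) = -imPart a := by
  simp only [imPart, star_neg, ← smul_neg]
  congr 1
  abel

theorem imPart_sub (a b : A) : imPart (a - b) = imPart a - imPart b := by
  rw [sub_eq_add_neg, imPart_add, imPart_neg, sub_eq_add_neg]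

theorem imPart_smul (r : ℝ) (a : A) : imPart (r • a) = r • imPart a := by
  simp only [imPart, star_smul, star_trivial, ← smul_sub]
  rw [smul_comm]

theorem norm_imPart_le (a : A) : ‖imPart a‖ ≤ ‖a‖ := by
  rw [imPart, norm_smul]
  have := norm_sub_le a (star a)
  rw [norm_star] at this
  simp only [norm_inv, norm_mul, Complex.norm_I, Complex.norm_ofNat]
  linarith

theorem isSelfAdjoint_imPart (a : A) : IsSelfAdjoint (imPart a) := by
  rw [IsSelfAdjoint, imPart, star_smul, star_sub, star_star, ← neg_sub, smul_neg, ← neg_smul]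
  congr 1
  simp

theorem two_I_smul_imPart (a : A) : (2 * Complex.I) • imPart a = a - star a := by
  rw [imPart, smul_inv_smul₀ (by simp)]

/-- Conjugating `Im W` by a right inverse `V` of `W` yields `-Im V`. -/
theorem star_mul_imPart_mul {V W : A} (h : W * V = 1) : star V * imPart W * V = -imPart V := by
  have h' : star V * star W = 1 := by rw [← star_mul, h, star_one]
  rw [imPart, imPart, mul_smul_comm, smul_mul_assoc, ← smul_neg, mul_sub, sub_mul, mul_assoc, h,
    h', mul_one, one_mul, neg_sub]

variable [PartialOrder A] [StarOrderedRing A]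

theorem mem_upperHalf_iff {a : A} :
    a ∈ upperHalf A ↔ ∃ ε : ℝ, 0 < ε ∧ algebraMap ℝ A ε ≤ imPart a := by
  simp only [upperHalf, Set.mem_ofPred_eq, Complex.coe_smul, Algebra.algebraMap_eq_smul_one]

theorem mem_lowerHalf_iff {a : A} :
    a ∈ lowerHalf A ↔ ∃ ε : ℝ, 0 < ε ∧ algebraMap ℝ A ε ≤ -imPart a := by
  rw [lowerHalf, Set.mem_ofPred_eq, mem_upperHalf_iff, imPart_neg]

theorem neg_imPart_add_norm_sub_le (a b : A) :
    -imPart a ≤ -imPart b + algebraMap ℝ A ‖b - a‖ := by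
  have h : imPart (b - a) ≤ algebraMap ℝ A ‖b - a‖ :=
    ((isSelfAdjoint_imPart _).le_algebraMap_norm_self).trans
      (algebraMap_mono A (norm_imPart_le _))
  rw [imPart_sub] at h
  calc -imPart a = -imPart b + (imPart b - imPart a) := by abel
    _ ≤ _ := by gcongr

/-- If `-Im a ≥ ε`, then the ball of radius `ε` around `a` lies in the lower half-plane. -/
theorem ball_subset_lowerHalf {a : A} {ε : ℝ} (ha : algebraMap ℝ A ε ≤ -imPart a) :
    ball a ε ⊆ lowerHalf A := by
  intro b hb
  rw [mem_ball, dist_eq_norm] at hb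
  refine mem_lowerHalf_iff.2 ⟨ε - ‖b - a‖, sub_pos.2 hb, ?_⟩
  rw [map_sub, sub_le_iff_le_add]
  exact ha.trans (neg_imPart_add_norm_sub_le a b)

theorem isOpen_lowerHalf : IsOpen (lowerHalf A) := by
  rw [Metric.isOpen_iff]
  intro a ha
  obtain ⟨ε, hε, h⟩ := mem_lowerHalf_iff.1 ha
  exact ⟨ε, hε, ball_subset_lowerHalf h⟩

theorem convex_lowerHalf : Convex ℝ (lowerHalf A) := by
  intro a ha b hb s t hs ht hst
  obtain ⟨ε, hε, h⟩ := mem_lowerHalf_iff.1 ha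
  obtain ⟨δ, hδ, h'⟩ := mem_lowerHalf_iff.1 hb
  refine mem_lowerHalf_iff.2 ⟨min ε δ, lt_min hε hδ, ?_⟩
  have h1 := smul_le_smul_of_nonneg_left ((algebraMap_mono A (min_le_left ε δ)).trans h) hs
  have h2 := smul_le_smul_of_nonneg_left ((algebraMap_mono A (min_le_right ε δ)).trans h') ht
  calc algebraMap ℝ A (min ε δ) = s • algebraMap ℝ A (min ε δ) + t • algebraMap ℝ A (min ε δ) := by
        rw [← add_smul, hst, one_smul]
    _ ≤ s • -imPart a + t • -imPart b := add_le_add h1 h2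
    _ = -imPart (s • a + t • b) := by
        rw [imPart_add, imPart_smul, imPart_smul, smul_neg, smul_neg, neg_add]

/-- An element with strictly positive imaginary part is invertible. -/
theorem isUnit_of_algebraMap_le_imPart {W : A} {c : ℝ} (hc : 0 < c)
    (h : algebraMap ℝ A c ≤ imPart W) : IsUnit W := by
  set s : ℝ := c / (‖W‖ ^ 2 + c ^ 2 + 1) with hs_def
  have hs : 0 < s := by positivity
  have hden : s * (‖W‖ ^ 2 + c ^ 2 + 1) = c := div_mul_cancel₀ _ (by positivity)
  have hsc : s * c ≤ 1 := by
    rw [hs_def, div_mul_eq_mul_div, div_le_one (by positivity)]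
    nlinarith [sq_nonneg ‖W‖]
  have hsW : s ^ 2 * ‖W‖ ^ 2 ≤ s * c := by
    have : s * ‖W‖ ^ 2 ≤ c := by nlinarith [sq_nonneg c]
    nlinarith
  set x : A := 1 + (Complex.I * s) • W with hx
  have hxx : star x * x = 1 - (2 * s) • imPart W + s ^ 2 • (star W * W) := by
    have e : (2 * s) • imPart W = -(Complex.I * s) • (W - star W) := by
      rw [← two_I_smul_imPart, smul_smul, ← Complex.coe_smul]
      congr 1
      push_cast
      linear_combination (2 * (s : ℂ)) * Complex.I_mul_I
    have e2 : s ^ 2 • (star W * W) = ((Complex.I * s) * (-(Complex.I * s))) • (star W * W) := by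
      rw [← Complex.coe_smul]
      congr 1
      push_cast
      linear_combination ((s : ℂ) ^ 2) * Complex.I_mul_I
    rw [e, e2, hx, star_add, star_one, star_smul]
    have : star (Complex.I * (s : ℂ)) = -(Complex.I * s) := by simp
    rw [this, add_mul, mul_add, mul_add, smul_mul_smul_comm, one_mul, one_mul, mul_one,
      mul_comm (-(Complex.I * (s : ℂ)))]
    module
  have hle : star x * x ≤ algebraMap ℝ A (1 - s * c) := by
    have h1 : algebraMap ℝ A (2 * s * c) ≤ (2 * s) • imPart W := by
      have := smul_le_smul_of_nonneg_left h (by positivity : (0 : ℝ) ≤ 2 * s)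
      rwa [Algebra.smul_def, ← map_mul] at this
    have h2 : s ^ 2 • (star W * W) ≤ algebraMap ℝ A (s * c) := by
      have := smul_le_smul_of_nonneg_left (CStarAlgebra.star_mul_le_algebraMap_norm_sq (a := W))
        (sq_nonneg s)
      rw [Algebra.smul_def (s ^ 2) (algebraMap ℝ A _), ← map_mul] at this
      exact this.trans (algebraMap_mono A hsW)
    calc star x * x ≤ 1 - algebraMap ℝ A (2 * s * c) + algebraMap ℝ A (s * c) := by
          rw [hxx]; gcongr
      _ = algebraMap ℝ A (1 - s * c) := by
          rw [← map_one (algebraMap ℝ A), ← map_sub, ← map_add]; congr 1; ring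
  have hnorm : ‖x‖ < 1 := by
    have := (CStarAlgebra.norm_le_iff_le_algebraMap (star x * x) (sub_nonneg.2 hsc)
      (star_mul_self_nonneg x)).2 hle
    rw [CStarRing.norm_star_mul_self] at this
    nlinarith [norm_nonneg x, mul_pos hs hc]
  have hu := isUnit_one_sub_of_norm_lt_one hnorm
  have hz : -(Complex.I * (s : ℂ)) ≠ 0 := by simp [hs.ne']
  have e : 1 - x = (Units.mk0 _ hz) • W := by
    rw [Units.smul_def, Units.val_mk0, hx, neg_smul]
    abel
  rwa [e, isUnit_smul_iff] at hu

/-- If `Im W ≥ c > 0`, then `‖W⁻¹‖ ≤ c⁻¹`. -/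
theorem norm_inverse_le_of_algebraMap_le_imPart {W : A} {c : ℝ} (hc : 0 < c)
    (h : algebraMap ℝ A c ≤ imPart W) : ‖Ring.inverse W‖ ≤ c⁻¹ := by
  have hu := isUnit_of_algebraMap_le_imPart hc h
  set V := Ring.inverse W
  have hV := star_mul_imPart_mul (Ring.mul_inverse_cancel W hu)
  have h1 := star_left_conjugate_le_conjugate h V
  rw [hV, ← Algebra.commutes, mul_assoc, ← Algebra.smul_def] at h1
  have h2 : 0 ≤ c • (star V * V) := smul_nonneg hc.le (star_mul_self_nonneg V)
  have h3 := CStarAlgebra.norm_le_norm_of_nonneg_of_le h2 h1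
  rw [norm_smul, CStarRing.norm_star_mul_self, Real.norm_of_nonneg hc.le, norm_neg] at h3
  have h4 := h3.trans (norm_imPart_le V)
  rcases (norm_nonneg V).eq_or_lt with h0 | h0
  · rw [← h0]; positivity
  · rw [le_inv_comm₀ h0 hc, inv_eq_one_div, le_div_iff₀ h0]
    nlinarith

/-- If `Im W ≥ c > 0`, then `-Im W⁻¹ ≥ c / ‖W‖²`. -/
theorem algebraMap_le_neg_imPart_inverse {W : A} {c M : ℝ} (hc : 0 < c) (hM : 0 < M)
    (hWM : ‖W‖ ≤ M) (h : algebraMap ℝ A c ≤ imPart W) :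
    algebraMap ℝ A (c / M ^ 2) ≤ -imPart (Ring.inverse W) := by
  have hu := isUnit_of_algebraMap_le_imPart hc h
  set V := Ring.inverse W
  have hWV : W * V = 1 := Ring.mul_inverse_cancel W hu
  have hV := star_mul_imPart_mul hWV
  have h1 := star_left_conjugate_le_conjugate h V
  rw [hV, ← Algebra.commutes, mul_assoc, ← Algebra.smul_def] at h1
  have h2 := star_left_conjugate_le_conjugate
    (CStarAlgebra.star_mul_le_algebraMap_norm_sq (a := W)) V
  have e : star V * (star W * W) * V = 1 := by
    rw [mul_assoc, mul_assoc, hWV, mul_one, ← star_mul, hWV, star_one]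
  rw [e, ← Algebra.commutes, mul_assoc, ← Algebra.smul_def] at h2
  have h3 : (1 : A) ≤ M ^ 2 • (star V * V) :=
    h2.trans (smul_le_smul_of_nonneg_right (by gcongr) (star_mul_self_nonneg V))
  have h4 := smul_le_smul_of_nonneg_left h3 (by positivity : 0 ≤ c / M ^ 2)
  rw [smul_smul, div_mul_cancel₀ _ (by positivity), ← Algebra.algebraMap_eq_smul_one] at h4
  exact h4.trans h1

/-- A strictly positive `H` satisfies `H ≥ ‖H⁻¹‖⁻¹`. -/
theorem algebraMap_inv_norm_inverse_le {H : A} {c : ℝ} (hc : 0 < c) (h : algebraMap ℝ A c ≤ H) :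
    algebraMap ℝ A ‖Ring.inverse H‖⁻¹ ≤ H := by
  nontriviality A
  have hpos : 0 ≤ H := (algebraMap_nonneg A hc.le).trans h
  obtain ⟨u, rfl⟩ : IsUnit H := CStarAlgebra.isUnit_of_le _ h
    ((IsUnit.mk0 c hc.ne').map (algebraMap ℝ A) |>.isStrictlyPositive (algebraMap_nonneg A hc.le))
  rw [Ring.inverse_unit]
  have hn : 0 < ‖((u⁻¹ : Aˣ) : A)‖ := norm_pos_iff.2 u⁻¹.ne_zero
  let v : Aˣ := Units.map (algebraMap ℝ A).toMonoidHom (Units.mk0 _ hn.ne')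
  have hv : (v : A) = algebraMap ℝ A ‖((u⁻¹ : Aˣ) : A)‖ := rfl
  have hv' : ((v⁻¹ : Aˣ) : A) = algebraMap ℝ A ‖((u⁻¹ : Aˣ) : A)‖⁻¹ := rfl
  rw [← hv']
  refine (CStarAlgebra.inv_le_iff hpos (hv ▸ algebraMap_nonneg A hn.le)).1 ?_
  rw [hv]
  exact (IsSelfAdjoint.of_nonneg (CFC.inv_nonneg_of_nonneg u hpos)).le_algebraMap_norm_self

end HalfPlane

theorem stmt15 {A : Type*} [CStarAlgebra A] [PartialOrder A] [StarOrderedRing A]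
    (R : A → A)
    (hRhol : DifferentiableOn ℂ R (lowerHalf A))
    (hRmap : Set.MapsTo R (lowerHalf A) (lowerHalf A))
    (hRbdd : ∀ r > (0 : ℝ), ∃ C : ℝ, ∀ B ∈ lowerHalf A ∩ ball (0 : A) r, ‖R B‖ ≤ C)
    (Z : A) (hZ : Z ∈ upperHalf A) :
    (DifferentiableOn ℂ (fun B => Ring.inverse (Z - R B)) (lowerHalf A) ∧
      Set.MapsTo (fun B => Ring.inverse (Z - R B)) (lowerHalf A) (lowerHalf A)) ∧
    (∀ B ∈ lowerHalf A, ‖Ring.inverse (Z - R B)‖ ≤ ‖Ring.inverse (imPart Z)‖) ∧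
    (∀ r > ‖Ring.inverse (imPart Z)‖,
      Set.MapsTo (fun B => Ring.inverse (Z - R B)) (ball (0 : A) r ∩ lowerHalf A)
        (ball (0 : A) r ∩ lowerHalf A) ∧
      ∃ ε > (0 : ℝ), ∀ x ∈ ball (0 : A) r ∩ lowerHalf A,
        ∀ y ∉ ball (0 : A) r ∩ lowerHalf A, ε ≤ ‖Ring.inverse (Z - R x) - y‖) ∧
    (∃ G ∈ lowerHalf A, Ring.inverse (Z - R G) = G ∧
      (∀ B ∈ lowerHalf A, Ring.inverse (Z - R B) = B → B = G) ∧
      ∀ B₀ ∈ lowerHalf A,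
        Tendsto (fun n => (fun B => Ring.inverse (Z - R B))^[n] B₀) atTop (nhds G)) := by
  obtain ⟨c, hc, hcZ⟩ := mem_upperHalf_iff.1 hZ
  set g : A → A := fun B => Ring.inverse (Z - R B)
  set h : ℝ := ‖Ring.inverse (imPart Z)‖
  have hIm : ∀ B ∈ lowerHalf A, imPart Z ≤ imPart (Z - R B) := by
    intro B hB
    obtain ⟨ε, hε, hle⟩ := mem_lowerHalf_iff.1 (hRmap hB)
    rw [imPart_sub, sub_eq_add_neg]
    exact le_add_of_nonneg_right ((algebraMap_nonneg A hε.le).trans hle)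
  have hunit : ∀ B ∈ lowerHalf A, IsUnit (Z - R B) := fun B hB =>
    isUnit_of_algebraMap_le_imPart hc (hcZ.trans (hIm B hB))
  have hdiff : DifferentiableOn ℂ g (lowerHalf A) := fun B hB =>
    ((hRhol B hB).const_sub Z).inverse (hunit B hB)
  have hnorm : ∀ B ∈ lowerHalf A, ‖g B‖ ≤ h := by
    intro B hB
    rcases subsingleton_or_nontrivial A with _ | _
    · rw [Subsingleton.elim (g B) 0, norm_zero]
      exact norm_nonneg _
    have hu : IsUnit (Ring.inverse (imPart Z)) :=
      (CStarAlgebra.isUnit_of_le _ hcZ ((IsUnit.mk0 c hc.ne').map (algebraMap ℝ A)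
        |>.isStrictlyPositive (algebraMap_nonneg A hc.le))).ringInverse
    have hpos : 0 < h := norm_pos_iff.2 hu.ne_zero
    simpa using norm_inverse_le_of_algebraMap_le_imPart (inv_pos.2 hpos)
      ((algebraMap_inv_norm_inverse_le hc hcZ).trans (hIm B hB))
  have hstrict : ∀ r > h, ∃ ε > (0 : ℝ), ∀ x ∈ ball (0 : A) r ∩ lowerHalf A,
      ball (g x) ε ⊆ ball (0 : A) r ∩ lowerHalf A := by
    intro r hr
    have hr0 : 0 < r := (norm_nonneg _).trans_lt hr
    obtain ⟨C, hC⟩ := hRbdd r hr0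
    set M : ℝ := ‖Z‖ + |C| + 1
    have hM : 0 < M := by positivity
    refine ⟨min (r - h) (c / M ^ 2), lt_min (sub_pos.2 hr) (by positivity), fun x hx => ?_⟩
    refine Set.subset_inter (fun y hy => ?_) ?_
    · rw [mem_ball_zero_iff]
      have h1 : ‖y - g x‖ < r - h := by
        rw [← dist_eq_norm]; exact (mem_ball.1 hy).trans_le (min_le_left _ _)
      linarith [norm_le_norm_add_norm_sub' y (g x), hnorm x hx.2]
    · refine (ball_subset_ball (min_le_right _ _)).trans (ball_subset_lowerHalf ?_)
      refine algebraMap_le_neg_imPart_inverse hc hM ?_ (hcZ.trans (hIm x hx.2))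
      linarith [norm_sub_le Z (R x), hC x ⟨hx.2, hx.1⟩, le_abs_self C]
  have hEH : ∀ r > h, (ball (0 : A) r ∩ lowerHalf A).Nonempty →
      ∃ G ∈ ball (0 : A) r ∩ lowerHalf A, g G = G ∧
        ∀ x ∈ ball (0 : A) r ∩ lowerHalf A, Tendsto (fun n => g^[n] x) atTop (nhds G) := by
    intro r hr hne
    obtain ⟨ε, hε, hb⟩ := hstrict r hr
    exact exists_fixedPoint_of_strictly_mapsTo (isOpen_ball.inter isOpen_lowerHalf)
      ((convex_ball 0 r).inter convex_lowerHalf)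
      (fun x hx => (mem_ball_zero_iff.1 hx.1).le) hne (hdiff.mono Set.inter_subset_right) hε hb
  have hmaps : ∀ r > h, Set.MapsTo g (ball (0 : A) r ∩ lowerHalf A)
      (ball (0 : A) r ∩ lowerHalf A) := fun r hr x hx => by
    obtain ⟨ε, hε, hb⟩ := hstrict r hr
    exact hb x hx (mem_ball_self hε)
  have hlarge : ∀ B : A, ∃ r > h, B ∈ ball (0 : A) r := fun B =>
    ⟨max h ‖B‖ + 1, by linarith [le_max_left h ‖B‖], by
      rw [mem_ball_zero_iff]; linarith [le_max_right h ‖B‖]⟩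
  refine ⟨⟨hdiff, fun B hB => ?_⟩, hnorm, fun r hr => ⟨hmaps r hr, ?_⟩, ?_⟩
  · obtain ⟨r, hr, hBr⟩ := hlarge B
    exact (hmaps r hr ⟨hBr, hB⟩).2
  · obtain ⟨ε, hε, hb⟩ := hstrict r hr
    refine ⟨ε, hε, fun x hx y hy => ?_⟩
    by_contra! hlt
    exact hy (hb x hx (by rwa [mem_ball, dist_comm, dist_eq_norm]))
  · have hZ' : -Z ∈ lowerHalf A := by rwa [lowerHalf, Set.mem_ofPred_eq, neg_neg]
    obtain ⟨r, hr, hZr⟩ := hlarge (-Z)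
    obtain ⟨G, hG, hfix, -⟩ := hEH r hr ⟨-Z, hZr, hZ'⟩
    have hlim : ∀ B ∈ lowerHalf A, Tendsto (fun n => g^[n] B) atTop (nhds G) := by
      intro B hB
      obtain ⟨r₁, hr₁, hBr₁⟩ := hlarge B
      obtain ⟨G', -, -, hG'lim⟩ := hEH (max r r₁) (lt_max_of_lt_left hr)
        ⟨G, ball_subset_ball (le_max_left _ _) hG.1, hG.2⟩
      have h1 := hG'lim G ⟨ball_subset_ball (le_max_left _ _) hG.1, hG.2⟩
      simp only [Function.iterate_fixed hfix] at h1
      rw [tendsto_nhds_unique tendsto_const_nhds h1]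
      exact hG'lim B ⟨ball_subset_ball (le_max_right _ _) hBr₁, hB⟩
    refine ⟨G, hG.2, hfix, fun B hB hBfix => ?_, hlim⟩
    have h1 := hlim B hB
    simp only [Function.iterate_fixed (show g B = B from hBfix)] at h1
    exact tendsto_nhds_unique tendsto_const_nhds h1
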